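/- arXiv:1910.09944 — 2 statements merged into one kernel-verified Lean document; each statement's English description precedes it below -/
import Mathlib

section
/- Let 𝔐 = (M^λ)_{λ>0} be an isotropically decomposable accelerating weight sequence system on ℝ^d satisfying (L). Then 𝔐 satisfies (𝔐.2)' if and only if for every λ > 0 there exists μ > 0 such that ∫_{ℝ^d} exp(ω_{M^λ}(x) − ω_{M^μ}(x)) dx < ∞. -/
open MeasureTheory Filter ENNReal Asymptotics

noncomputable section

/-- Partial derivative in the `i`-th coordinate direction. -/
def pd (d : ℕ) (i : Fin d) (f : EuclideanSpace ℝ (Fin d) → ℂ) :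
    EuclideanSpace ℝ (Fin d) → ℂ :=
  fun x => fderiv ℝ f x (EuclideanSpace.single i 1)

/-- Iterated partial derivative in the `i`-th coordinate direction. -/
def pdPow (d : ℕ) (i : Fin d) :
    ℕ → (EuclideanSpace ℝ (Fin d) → ℂ) → EuclideanSpace ℝ (Fin d) → ℂ
  | 0, f => f
  | n + 1, f => pd d i (pdPow d i n f)

/-- Mixed partial derivative `∂^α` for a multi-index `α : Fin d → ℕ`. -/
def pdMulti (d : ℕ) (α : Fin d → ℕ) (f : EuclideanSpace ℝ (Fin d) → ℂ) :
    EuclideanSpace ℝ (Fin d) → ℂ :=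
  (List.finRange d).foldr (fun i g => pdPow d i (α i) g) f

/-- The Gelfand–Shilov seminorm `‖φ‖_{𝒮^M_{w,q}}`, as an `ℝ≥0∞`-valued quantity:
`sup_α ‖(∂^α φ)·w‖_{L^q} / M_α`. -/
def gsNorm (d : ℕ) (M : (Fin d → ℕ) → ℝ) (w : EuclideanSpace ℝ (Fin d) → ℝ)
    (q : ℝ≥0∞) (φ : EuclideanSpace ℝ (Fin d) → ℂ) : ℝ≥0∞ :=
  ⨆ α : Fin d → ℕ,
    eLpNorm (fun x => ‖pdMulti d α φ x‖ * w x) q volume / ENNReal.ofReal (M α)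

/-- The lattice point of `ℤ^d` inside `ℝ^d`. -/
def intPt (d : ℕ) (j : Fin d → ℤ) : EuclideanSpace ℝ (Fin d) :=
  (WithLp.equiv 2 (Fin d → ℝ)).symm fun i => (j i : ℝ)

/-- The associated function `ω_M(x) = sup_α log (|x^α| M_0 / M_α)` of a (multi-indexed)
sequence `M`. -/
def assocFun (d : ℕ) (M : (Fin d → ℕ) → ℝ) (x : EuclideanSpace ℝ (Fin d)) : ℝ :=
  ⨆ α : Fin d → ℕ, Real.log ((∏ i, |x i| ^ α i) * M 0 / M α)

/-- `w` is a weight function system on `ℝ^d`: each `w λ` (for `λ > 0`) is continuous, `≥ 1`,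
and `w λ ≤ w μ` pointwise whenever `μ ≤ λ`. -/
structure IsWFS (d : ℕ) (w : ℝ → EuclideanSpace ℝ (Fin d) → ℝ) : Prop where
  cont : ∀ l, 0 < l → Continuous (w l)
  one_le : ∀ l, 0 < l → ∀ x, 1 ≤ w l x
  mono : ∀ m l, 0 < m → m ≤ l → ∀ x, w l x ≤ w m x

/-- Condition (wM) (Beurling) for a weight function system. -/
def WFS_wM_B (d : ℕ) (w : ℝ → EuclideanSpace ℝ (Fin d) → ℝ) : Prop :=
  ∀ l, 0 < l → ∃ m, 0 < m ∧ ∃ C, 0 < C ∧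
    ∀ x y : EuclideanSpace ℝ (Fin d), ‖y‖ ≤ 1 → w l (x + y) ≤ C * w m x

/-- Condition {wM} (Roumieu) for a weight function system. -/
def WFS_wM_R (d : ℕ) (w : ℝ → EuclideanSpace ℝ (Fin d) → ℝ) : Prop :=
  ∀ m, 0 < m → ∃ l, 0 < l ∧ ∃ C, 0 < C ∧
    ∀ x y : EuclideanSpace ℝ (Fin d), ‖y‖ ≤ 1 → w l (x + y) ≤ C * w m x

/-- Condition (M) (Beurling) for a weight function system. -/
def WFS_M_B (d : ℕ) (w : ℝ → EuclideanSpace ℝ (Fin d) → ℝ) : Prop :=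
  ∀ l, 0 < l → ∃ m, 0 < m ∧ ∃ n, 0 < n ∧ ∃ C, 0 < C ∧
    ∀ x y : EuclideanSpace ℝ (Fin d), w l (x + y) ≤ C * w m x * w n y

/-- Condition (N) (Beurling) for a weight function system. -/
def WFS_N_B (d : ℕ) (w : ℝ → EuclideanSpace ℝ (Fin d) → ℝ) : Prop :=
  ∀ l, 0 < l → ∃ m, 0 < m ∧ Integrable (fun x => w l x / w m x) volume

/-- Condition {N} (Roumieu) for a weight function system. -/
def WFS_N_R (d : ℕ) (w : ℝ → EuclideanSpace ℝ (Fin d) → ℝ) : Prop :=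
  ∀ m, 0 < m → ∃ l, 0 < l ∧ Integrable (fun x => w l x / w m x) volume

/-- `M` is a weight sequence system on `ℝ^d`: each `M λ` (for `λ > 0`) is a positive
sequence with `(M^λ_α)^{1/|α|} → ∞` satisfying the log-convexity condition (M.1), and
`M^λ_α ≤ M^μ_α` whenever `λ ≤ μ`. -/
structure IsWSS (d : ℕ) (M : ℝ → (Fin d → ℕ) → ℝ) : Prop where
  pos : ∀ l, 0 < l → ∀ α, 0 < M l α
  growth : ∀ l, 0 < l → ∀ R : ℝ, 0 < R → ∃ N : ℕ, ∀ α : Fin d → ℕ,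
    N ≤ ∑ i, α i → R ^ (∑ i, α i) ≤ M l α
  logconvex : ∀ l, 0 < l → ∀ (α : Fin d → ℕ) (j : Fin d),
    M l (α + Pi.single j 1) ^ 2 ≤ M l α * M l (α + Pi.single j 2)
  mono : ∀ l m, 0 < l → l ≤ m → ∀ α, M l α ≤ M m α

/-- Condition (L) (Beurling) for a weight sequence system. -/
def WSS_L_B (d : ℕ) (M : ℝ → (Fin d → ℕ) → ℝ) : Prop :=
  ∀ R : ℝ, 0 < R → ∀ l, 0 < l → ∃ m, 0 < m ∧ ∃ C, 0 < C ∧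
    ∀ α : Fin d → ℕ, R ^ (∑ i, α i) * M m α ≤ C * M l α

/-- Condition {L} (Roumieu) for a weight sequence system. -/
def WSS_L_R (d : ℕ) (M : ℝ → (Fin d → ℕ) → ℝ) : Prop :=
  ∀ R : ℝ, 0 < R → ∀ m, 0 < m → ∃ l, 0 < l ∧ ∃ C, 0 < C ∧
    ∀ α : Fin d → ℕ, R ^ (∑ i, α i) * M m α ≤ C * M l α

/-- Condition (𝔐.2)' (Beurling) for a weight sequence system. -/
def WSS_M2_B (d : ℕ) (M : ℝ → (Fin d → ℕ) → ℝ) : Prop :=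
  ∀ l, 0 < l → ∃ m, 0 < m ∧ ∃ C, 0 < C ∧ ∃ H, 0 < H ∧
    ∀ (α : Fin d → ℕ) (j : Fin d),
      M m (α + Pi.single j 1) ≤ C * H ^ (∑ i, α i) * M l α

/-- Condition {𝔐.2}' (Roumieu) for a weight sequence system. -/
def WSS_M2_R (d : ℕ) (M : ℝ → (Fin d → ℕ) → ℝ) : Prop :=
  ∀ m, 0 < m → ∃ l, 0 < l ∧ ∃ C, 0 < C ∧ ∃ H, 0 < H ∧
    ∀ (α : Fin d → ℕ) (j : Fin d),
      M l (α + Pi.single j 1) ≤ C * H ^ (∑ i, α i) * M m α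

/-- A weight sequence system is accelerating if `M^λ_{α+e_j}/M^λ_α ≤ M^μ_{α+e_j}/M^μ_α`
for `λ ≤ μ`. -/
def WSSAccel (d : ℕ) (M : ℝ → (Fin d → ℕ) → ℝ) : Prop :=
  ∀ l m, 0 < l → l ≤ m → ∀ (α : Fin d → ℕ) (j : Fin d),
    M l (α + Pi.single j 1) / M l α ≤ M m (α + Pi.single j 1) / M m α

/-- A weight sequence system is isotropically decomposable: there is a partition of the `d`
coordinates into `k` blocks (equivalently, after a permutation of the coordinates, a
decomposition `ℕ^d = ℕ^{d_1} × ⋯ × ℕ^{d_k}`) and positive functions `m^λ_j : ℕ → (0,∞)` with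
`M^λ_α = ∏_j m^λ_j (|α^{(j)}|)`. -/
def IsoDecomposable (d : ℕ) (M : ℝ → (Fin d → ℕ) → ℝ) : Prop :=
  ∃ (k : ℕ) (b : Fin d → Fin k) (m : ℝ → Fin k → ℕ → ℝ),
    (∀ l, 0 < l → ∀ j n, 0 < m l j n) ∧
    ∀ l, 0 < l → ∀ α : Fin d → ℕ,
      M l α = ∏ j, m l j (∑ i ∈ Finset.univ.filter fun i => b i = j, α i)

/-- Membership in the Beurling Gelfand–Shilov class `𝒮^{(𝔐)}_{(𝒲),q}`. -/
def gsBeurling (d : ℕ) (M : ℝ → (Fin d → ℕ) → ℝ) (w : ℝ → EuclideanSpace ℝ (Fin d) → ℝ)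
    (q : ℝ≥0∞) (φ : EuclideanSpace ℝ (Fin d) → ℂ) : Prop :=
  ContDiff ℝ (⊤ : ℕ∞) φ ∧ ∀ l, 0 < l → gsNorm d (M l) (w l) q φ < ⊤

/-- Membership in the Roumieu Gelfand–Shilov class `𝒮^{{𝔐}}_{{𝒲},q}`. -/
def gsRoumieu (d : ℕ) (M : ℝ → (Fin d → ℕ) → ℝ) (w : ℝ → EuclideanSpace ℝ (Fin d) → ℝ)
    (q : ℝ≥0∞) (φ : EuclideanSpace ℝ (Fin d) → ℂ) : Prop :=
  ContDiff ℝ (⊤ : ℕ∞) φ ∧ ∃ l, 0 < l ∧ gsNorm d (M l) (w l) q φ < ⊤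

/-- Membership in the auxiliary space `𝒮̃^{(𝔐)}_{(𝒲)}`. -/
def gsTilde (d : ℕ) (M : ℝ → (Fin d → ℕ) → ℝ) (w : ℝ → EuclideanSpace ℝ (Fin d) → ℝ)
    (ψ : EuclideanSpace ℝ (Fin d) → ℂ) : Prop :=
  ContDiff ℝ (⊤ : ℕ∞) ψ ∧ ∀ l, 0 < l → ∀ k : ℕ, ∃ C : ℝ,
    ∀ (α : Fin d → ℕ) (x : EuclideanSpace ℝ (Fin d)),
      ‖pdMulti d α ψ x‖ * (1 + ‖x‖) ^ k * w l x / M l α ≤ C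

end

/-- The quotient `|x^α| M_0 / M_α` whose logarithms define the associated function. -/
noncomputable def assocTerm (d : ℕ) (M : (Fin d → ℕ) → ℝ) (x : EuclideanSpace ℝ (Fin d))
    (α : Fin d → ℕ) : ℝ :=
  (∏ i, |x i| ^ α i) * M 0 / M α

/-- The exponential of the associated function of a one-dimensional sequence. -/
noncomputable def seqAssoc (a : ℕ → ℝ) (t : ℝ) : ℝ := ⨆ n : ℕ, t ^ n * a 0 / a n

section Sequences

variable {a b : ℕ → ℝ} {s t : ℝ}

theorem seqAssoc_nonneg (ha : ∀ n, 0 < a n) (ht : 0 ≤ t) : 0 ≤ seqAssoc a t :=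
  Real.iSup_nonneg fun n => by have := ha n; have := ha 0; positivity

theorem le_seqAssoc (hb : BddAbove (Set.range fun n => t ^ n * a 0 / a n)) (n : ℕ) :
    t ^ n * a 0 / a n ≤ seqAssoc a t :=
  le_ciSup hb n

theorem seqAssoc_pos (ha : ∀ n, 0 < a n)
    (hb : BddAbove (Set.range fun n => t ^ n * a 0 / a n)) : 0 < seqAssoc a t := by
  refine lt_of_lt_of_le ?_ (le_seqAssoc hb 0)
  have := ha 0
  simp [this.ne']

theorem seqAssoc_le_of_le (ha : ∀ n, 0 < a n) (hb : ∀ n, 0 < b n) (hab : ∀ n, a n ≤ b n)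
    (ht : 0 ≤ t) (hbd : BddAbove (Set.range fun n => t ^ n * a 0 / a n)) :
    seqAssoc b t ≤ b 0 / a 0 * seqAssoc a t := by
  have ha0 := ha 0
  have hb0 := hb 0
  refine ciSup_le fun n => ?_
  calc t ^ n * b 0 / b n ≤ t ^ n * b 0 / a n :=
        div_le_div_of_nonneg_left (by positivity) (ha n) (hab n)
    _ = b 0 / a 0 * (t ^ n * a 0 / a n) := by field_simp
    _ ≤ _ := by gcongr; exact le_seqAssoc hbd n

theorem antitone_div_of_ratio_le (ha : ∀ n, 0 < a n) (hb : ∀ n, 0 < b n)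
    (hab : ∀ n, a (n + 1) / a n ≤ b (n + 1) / b n) : Antitone fun n => a n / b n := by
  refine antitone_nat_of_succ_le fun n => ?_
  have h := hab n
  rw [div_le_div_iff₀ (ha _) (hb _)] at h
  rw [div_le_div_iff₀ (hb _) (hb _)]
  linarith

theorem seqAssoc_mul_le_mul (ha : ∀ n, 0 < a n) (hb : ∀ n, 0 < b n)
    (hab : ∀ n, a (n + 1) / a n ≤ b (n + 1) / b n) (hs : 0 < s) (hst : s ≤ t)
    (has : BddAbove (Set.range fun n => s ^ n * a 0 / a n))
    (hat : BddAbove (Set.range fun n => t ^ n * a 0 / a n))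
    (hbs : BddAbove (Set.range fun n => s ^ n * b 0 / b n)) :
    seqAssoc b t * seqAssoc a s ≤ seqAssoc b s * seqAssoc a t := by
  have ht := hs.trans_le hst
  have ha0 := ha 0
  have hb0 := hb 0
  have key : ∀ p q : ℕ, t ^ p * b 0 / b p * (s ^ q * a 0 / a q)
      ≤ seqAssoc b s * seqAssoc a t := by
    intro p q
    have hp := ha p
    have hq := ha q
    have hp' := hb p
    have hq' := hb q
    have hbs0 := seqAssoc_nonneg hb hs.le
    rcases le_total q p with h | h
    · have h1 : a p / b p ≤ a q / b q := antitone_div_of_ratio_le ha hb hab h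
      rw [div_le_div_iff₀ hp' hq'] at h1
      calc t ^ p * b 0 / b p * (s ^ q * a 0 / a q)
          = t ^ p * b 0 * s ^ q * a 0 / (a q * b p) := by field_simp
        _ ≤ t ^ p * b 0 * s ^ q * a 0 / (a p * b q) :=
            div_le_div_of_nonneg_left (by positivity) (by positivity) h1
        _ = s ^ q * b 0 / b q * (t ^ p * a 0 / a p) := by field_simp
        _ ≤ _ := mul_le_mul (le_seqAssoc hbs q) (le_seqAssoc hat p) (by positivity) hbs0
    · obtain ⟨k, rfl⟩ := Nat.exists_eq_add_of_le h
      calc t ^ p * b 0 / b p * (s ^ (p + k) * a 0 / a (p + k))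
          = s ^ p * b 0 / b p * (s ^ k * (t ^ p * a 0 / a (p + k))) := by
            rw [pow_add]; ring
        _ ≤ s ^ p * b 0 / b p * (t ^ k * (t ^ p * a 0 / a (p + k))) := by gcongr
        _ = s ^ p * b 0 / b p * (t ^ (p + k) * a 0 / a (p + k)) := by
            rw [pow_add]; ring
        _ ≤ _ := mul_le_mul (le_seqAssoc hbs p) (le_seqAssoc hat _) (by positivity) hbs0
  have hpos := seqAssoc_pos ha has
  rw [← le_div_iff₀ hpos]
  refine ciSup_le fun p => ?_
  have hterm : 0 < t ^ p * b 0 / b p := by have := hb p; positivity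
  rw [le_div_iff₀ hpos, mul_comm, ← le_div_iff₀ hterm]
  refine ciSup_le fun q => ?_
  rw [le_div_iff₀ hterm, mul_comm]
  exact key p q

/-- For a log-convex sequence the supremum defining `seqAssoc a` at the ratio
`a (n + 1) / a n` is attained at `n + 1`. -/
theorem seqAssoc_ratio_le (ha : ∀ n, 0 < a n) (hlc : ∀ n, a (n + 1) ^ 2 ≤ a n * a (n + 2))
    (n : ℕ) :
    seqAssoc a (a (n + 1) / a n) ≤ (a (n + 1) / a n) ^ (n + 1) * a 0 / a (n + 1) := by
  have hmono : Monotone fun n => a (n + 1) / a n := by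
    refine monotone_nat_of_le_succ fun k => ?_
    rw [div_le_div_iff₀ (ha _) (ha _)]
    nlinarith [hlc k]
  set r := a (n + 1) / a n with hr
  have hrpos : 0 < r := div_pos (ha _) (ha _)
  have hstep : r ^ (n + 1) / a (n + 1) = r ^ n / a n := by
    have := (ha n).ne'
    have := (ha (n + 1)).ne'
    rw [pow_succ, hr]; field_simp
  have hup : ∀ k, n ≤ k → r ^ k / a k ≤ r ^ n / a n := by
    intro k hk
    induction k, hk using Nat.le_induction with
    | base => exact le_rfl
    | succ k hk ih =>
      refine le_trans ?_ ih
      have h : r ≤ a (k + 1) / a k := hmono hk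
      rw [le_div_iff₀ (ha _)] at h
      rw [div_le_div_iff₀ (ha _) (ha _), pow_succ]
      have := pow_pos hrpos k
      nlinarith
  have hdown : ∀ k, k ≤ n → r ^ k / a k ≤ r ^ n / a n := by
    intro k hk
    induction hk using Nat.decreasingInduction with
    | self => exact le_rfl
    | of_succ k hk ih =>
      refine le_trans ?_ ih
      have h : a (k + 1) / a k ≤ r := hmono (Nat.le_of_lt hk)
      rw [div_le_iff₀ (ha _)] at h
      rw [div_le_div_iff₀ (ha _) (ha _), pow_succ]
      have := pow_pos hrpos k
      nlinarith
  refine ciSup_le fun k => ?_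
  rw [mul_div_right_comm, mul_div_right_comm, hstep]
  have := ha 0
  refine mul_le_mul_of_nonneg_right ?_ this.le
  rcases le_total n k with h | h
  exacts [hup k h, hdown k h]

theorem succ_le_of_mul_seqAssoc_le (ha : ∀ n, 0 < a n) (hb : ∀ n, 0 < b n)
    (hlc : ∀ n, a (n + 1) ^ 2 ≤ a n * a (n + 2))
    (hbd : ∀ t, 0 < t → BddAbove (Set.range fun n => t ^ n * b 0 / b n)) {C : ℝ}
    (hC : 0 ≤ C) (h : ∀ t, 0 < t → t * seqAssoc b t ≤ C * seqAssoc a t) (n : ℕ) :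
    a (n + 1) ≤ C * a 0 / b 0 * b n := by
  set r := a (n + 1) / a n with hr
  have hrpos : 0 < r := div_pos (ha _) (ha _)
  have ha1 := ha (n + 1)
  have hbn := hb n
  have hb0 := hb 0
  have ha0 := ha 0
  have h1 : r * (r ^ n * b 0 / b n) ≤ C * (r ^ (n + 1) * a 0 / a (n + 1)) :=
    calc _ ≤ r * seqAssoc b r := by gcongr; exact le_seqAssoc (hbd r hrpos) n
      _ ≤ C * seqAssoc a r := h r hrpos
      _ ≤ _ := by gcongr; exact seqAssoc_ratio_le ha hlc n
  have h2 : r ^ (n + 1) * (b 0 / b n) ≤ r ^ (n + 1) * (C * a 0 / a (n + 1)) := by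
    calc _ = r * (r ^ n * b 0 / b n) := by ring
      _ ≤ _ := h1
      _ = _ := by ring
  have h3 := le_of_mul_le_mul_left h2 (by positivity)
  rw [div_le_div_iff₀ hbn ha1] at h3
  rw [div_mul_eq_mul_div, le_div_iff₀ hb0]
  linarith

end Sequences

section AssociatedFunction

variable {d : ℕ} {M : (Fin d → ℕ) → ℝ}

theorem assocTerm_nonneg (hpos : ∀ α, 0 < M α) (x : EuclideanSpace ℝ (Fin d))
    (α : Fin d → ℕ) : 0 ≤ assocTerm d M x α := by
  exact div_nonneg (mul_nonneg (Finset.prod_nonneg fun i _ => by positivity) (hpos 0).le)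
    (hpos α).le

theorem bddAbove_assocTerm (hpos : ∀ α, 0 < M α)
    (hgr : ∀ R : ℝ, 0 < R → ∃ N : ℕ, ∀ α : Fin d → ℕ,
      N ≤ ∑ i, α i → R ^ (∑ i, α i) ≤ M α) (x : EuclideanSpace ℝ (Fin d)) :
    BddAbove (Set.range (assocTerm d M x)) := by
  obtain ⟨N, hN⟩ := hgr (‖x‖ + 1) (by positivity)
  have hfin : {α : Fin d → ℕ | ∑ i, α i < N}.Finite := by
    refine (Set.finite_Iic fun _ : Fin d => N).subset fun α hα i => ?_
    have h : α i ≤ ∑ i, α i := Finset.single_le_sum (fun _ _ => Nat.zero_le _) (Finset.mem_univ i)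
    have hα' : ∑ i, α i < N := hα
    exact (h.trans hα'.le)
  obtain ⟨B, hB⟩ := (hfin.image (assocTerm d M x)).bddAbove
  refine ⟨max B (M 0), ?_⟩
  rintro _ ⟨α, rfl⟩
  rcases lt_or_ge (∑ i, α i) N with h | h
  · exact le_max_of_le_left (hB ⟨α, h, rfl⟩)
  · refine le_max_of_le_right ?_
    have h0 := hpos 0
    rw [assocTerm, div_le_iff₀ (hpos α), mul_comm]
    gcongr
    refine le_trans ?_ (hN α h)
    rw [← Finset.prod_pow_eq_pow_sum]
    refine Finset.prod_le_prod (fun i _ => by positivity) fun i _ => ?_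
    gcongr
    have := PiLp.norm_apply_le x i
    rw [Real.norm_eq_abs] at this
    linarith

theorem assocTerm_le_exp (hpos : ∀ α, 0 < M α) {x : EuclideanSpace ℝ (Fin d)}
    (hbd : BddAbove (Set.range (assocTerm d M x))) (α : Fin d → ℕ) :
    assocTerm d M x α ≤ Real.exp (assocFun d M x) := by
  rcases (assocTerm_nonneg hpos x α).eq_or_lt with h | h
  · rw [← h]; positivity
  · have hlog : BddAbove (Set.range fun α => Real.log (assocTerm d M x α)) := by
      obtain ⟨B, hB⟩ := hbd
      refine ⟨B, ?_⟩
      rintro _ ⟨β, rfl⟩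
      exact (Real.log_le_self (assocTerm_nonneg hpos x β)).trans (hB ⟨β, rfl⟩)
    rw [← Real.exp_log h]
    exact Real.exp_le_exp.2 (le_ciSup hlog α)

theorem exp_assocFun_le (hpos : ∀ α, 0 < M α) {x : EuclideanSpace ℝ (Fin d)} {B : ℝ}
    (hB : ∀ α, assocTerm d M x α ≤ B) : Real.exp (assocFun d M x) ≤ B := by
  have hB1 : 1 ≤ B := by
    have h := hB 0
    have h0 := (hpos 0).ne'
    simpa [assocTerm, h0] using h
  rw [← Real.le_log_iff_exp_le (by linarith)]
  refine ciSup_le fun α => ?_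
  change Real.log (assocTerm d M x α) ≤ _
  rcases (assocTerm_nonneg hpos x α).eq_or_lt with h | h
  · rw [← h, Real.log_zero]; exact Real.log_nonneg hB1
  · exact Real.log_le_log h (hB α)

end AssociatedFunction

section System

variable {d : ℕ} {M : ℝ → (Fin d → ℕ) → ℝ} {l m : ℝ}

theorem IsWSS.bddAbove (hM : IsWSS d M) (hl : 0 < l) (x : EuclideanSpace ℝ (Fin d)) :
    BddAbove (Set.range (assocTerm d (M l) x)) :=
  bddAbove_assocTerm (hM.pos l hl) (hM.growth l hl) x

theorem assocTerm_le_of_le (hM : IsWSS d M) (hm : 0 < m) (hml : m ≤ l)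
    (x : EuclideanSpace ℝ (Fin d)) (α : Fin d → ℕ) :
    assocTerm d (M l) x α ≤ M l 0 / M m 0 * assocTerm d (M m) x α := by
  have hl := hm.trans_le hml
  have h1 := hM.pos m hm 0
  have h2 := hM.pos l hl 0
  have h3 := hM.pos m hm α
  unfold assocTerm
  calc (∏ i, |x i| ^ α i) * M l 0 / M l α ≤ (∏ i, |x i| ^ α i) * M l 0 / M m α := by
        refine div_le_div_of_nonneg_left ?_ h3 (hM.mono m l hm hml α)
        exact mul_nonneg (Finset.prod_nonneg fun i _ => by positivity) h2.le
    _ = _ := by field_simp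

theorem exp_assocFun_le_of_le (hM : IsWSS d M) (hm : 0 < m) (hml : m ≤ l)
    (x : EuclideanSpace ℝ (Fin d)) :
    Real.exp (assocFun d (M l) x) ≤ M l 0 / M m 0 * Real.exp (assocFun d (M m) x) := by
  have hl := hm.trans_le hml
  have h1 := hM.pos m hm 0
  have h2 := hM.pos l hl 0
  refine exp_assocFun_le (hM.pos l hl) fun α => (assocTerm_le_of_le hM hm hml x α).trans ?_
  gcongr
  exact assocTerm_le_exp (hM.pos m hm) (hM.bddAbove hm x) α

/-- Under (L), the geometric factor in (𝔐.2)' can be absorbed. -/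
theorem exists_succ_le_const_mul (hL : WSS_L_B d M) (h2 : WSS_M2_B d M) (hl : 0 < l) :
    ∃ m, 0 < m ∧ ∃ C, 0 < C ∧ ∀ (α : Fin d → ℕ) (j : Fin d),
      M m (α + Pi.single j 1) ≤ C * M l α := by
  obtain ⟨n, hn, C, hC, H, hH, h⟩ := h2 l hl
  obtain ⟨m, hm, C', hC', h'⟩ := hL H hH n hn
  refine ⟨m, hm, C' * C / H, by positivity, fun α j => ?_⟩
  have e := h' (α + Pi.single j 1)
  have hs : ∑ i, (α + Pi.single j 1 : Fin d → ℕ) i = ∑ i, α i + 1 := by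
    simp [Finset.sum_add_distrib]
  rw [hs] at e
  have hP : 0 < H ^ (∑ i, α i) := by positivity
  have e2 : H ^ (∑ i, α i) * (H * M m (α + Pi.single j 1))
      ≤ H ^ (∑ i, α i) * (C' * C * M l α) :=
    calc _ = H ^ (∑ i, α i + 1) * M m (α + Pi.single j 1) := by ring
      _ ≤ _ := e
      _ ≤ C' * (C * H ^ (∑ i, α i) * M l α) := by gcongr; exact h α j
      _ = _ := by ring
  have e3 := le_of_mul_le_mul_left e2 hP
  rw [div_mul_eq_mul_div, le_div_iff₀ hH]
  linarith

theorem EuclideanSpace.norm_le_sum_abs (x : EuclideanSpace ℝ (Fin d)) : ‖x‖ ≤ ∑ i, |x i| := by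
  rw [EuclideanSpace.norm_eq]
  refine Real.sqrt_le_iff.2 ⟨Finset.sum_nonneg fun i _ => abs_nonneg _, ?_⟩
  simp only [Real.norm_eq_abs]
  exact Finset.sum_sq_le_sq_sum_of_nonneg fun i _ => abs_nonneg _

theorem exists_one_add_norm_mul_exp_le (hM : IsWSS d M) (hL : WSS_L_B d M)
    (h2 : WSS_M2_B d M) (hl : 0 < l) :
    ∃ m, 0 < m ∧ ∃ C, 0 < C ∧ ∀ x : EuclideanSpace ℝ (Fin d),
      (1 + ‖x‖) * Real.exp (assocFun d (M l) x) ≤ C * Real.exp (assocFun d (M m) x) := by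
  obtain ⟨m', hm', C, hC, h⟩ := exists_succ_le_const_mul hL h2 hl
  set m := min m' l
  have hm : 0 < m := lt_min hm' hl
  have hl0 := hM.pos l hl 0
  have hm0 := hM.pos m hm 0
  refine ⟨m, hm, M l 0 / M m 0 + d * (C * M l 0 / M m 0), by positivity, fun x => ?_⟩
  have hx : 0 < 1 + ‖x‖ := by positivity
  rw [mul_comm, ← le_div_iff₀ hx]
  refine exp_assocFun_le (hM.pos l hl) fun α => ?_
  rw [le_div_iff₀ hx, mul_comm]
  have hα := hM.pos l hl α
  have hstep : ∀ j, |x j| * assocTerm d (M l) x α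
      ≤ C * M l 0 / M m 0 * Real.exp (assocFun d (M m) x) := by
    intro j
    have hα' := hM.pos m hm (α + Pi.single j 1)
    have hprod : ∏ i, |x i| ^ (α + Pi.single j 1 : Fin d → ℕ) i = |x j| * ∏ i, |x i| ^ α i := by
      simp only [Pi.add_apply, pow_add, Finset.prod_mul_distrib]
      rw [mul_comm]
      congr 1
      rw [Finset.prod_eq_single j (fun i _ hi => by simp [hi]) (by simp)]
      simp
    have hP : 0 ≤ ∏ i, |x i| ^ α i := Finset.prod_nonneg fun i _ => by positivity
    have hle : M m (α + Pi.single j 1) ≤ C * M l α :=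
      (hM.mono m m' hm (min_le_left _ _) _).trans (h α j)
    calc |x j| * assocTerm d (M l) x α
        = C * (|x j| * (∏ i, |x i| ^ α i) * M l 0) / (C * M l α) := by
          unfold assocTerm; field_simp
      _ ≤ C * (|x j| * (∏ i, |x i| ^ α i) * M l 0) / M m (α + Pi.single j 1) :=
          div_le_div_of_nonneg_left (by positivity) hα' hle
      _ = C * M l 0 / M m 0 * assocTerm d (M m) x (α + Pi.single j 1) := by
          unfold assocTerm; rw [hprod]; field_simp
      _ ≤ _ := by gcongr; exact assocTerm_le_exp (hM.pos m hm) (hM.bddAbove hm x) _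
  have hT := assocTerm_nonneg (hM.pos l hl) x α
  calc (1 + ‖x‖) * assocTerm d (M l) x α
      ≤ (1 + ∑ j, |x j|) * assocTerm d (M l) x α := by
        gcongr; exact EuclideanSpace.norm_le_sum_abs x
    _ = assocTerm d (M l) x α + ∑ j, |x j| * assocTerm d (M l) x α := by
        rw [add_mul, one_mul, Finset.sum_mul]
    _ ≤ M l 0 / M m 0 * Real.exp (assocFun d (M m) x)
        + ∑ _j : Fin d, C * M l 0 / M m 0 * Real.exp (assocFun d (M m) x) := by
        refine add_le_add ?_ (Finset.sum_le_sum fun j _ => hstep j)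
        refine (assocTerm_le_of_le hM hm (min_le_right _ _) x α).trans ?_
        gcongr
        exact assocTerm_le_exp (hM.pos m hm) (hM.bddAbove hm x) α
    _ = _ := by simp; ring

theorem exists_one_add_norm_pow_mul_exp_le (hM : IsWSS d M) (hL : WSS_L_B d M)
    (h2 : WSS_M2_B d M) (k : ℕ) (hl : 0 < l) :
    ∃ m, 0 < m ∧ ∃ C, 0 < C ∧ ∀ x : EuclideanSpace ℝ (Fin d),
      (1 + ‖x‖) ^ k * Real.exp (assocFun d (M l) x)
        ≤ C * Real.exp (assocFun d (M m) x) := by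
  induction k with
  | zero => exact ⟨l, hl, 1, one_pos, fun x => by simp⟩
  | succ k ih =>
    obtain ⟨n, hn, C, hC, h⟩ := ih
    obtain ⟨m, hm, C', hC', h'⟩ := exists_one_add_norm_mul_exp_le hM hL h2 hn
    refine ⟨m, hm, C * C', by positivity, fun x => ?_⟩
    calc _ = (1 + ‖x‖) * ((1 + ‖x‖) ^ k * Real.exp (assocFun d (M l) x)) := by ring
      _ ≤ (1 + ‖x‖) * (C * Real.exp (assocFun d (M n) x)) := mul_le_mul_of_nonneg_left (h x) (by positivity)
      _ = C * ((1 + ‖x‖) * Real.exp (assocFun d (M n) x)) := by ring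
      _ ≤ C * (C' * Real.exp (assocFun d (M m) x)) := mul_le_mul_of_nonneg_left (h' x) hC.le
      _ = _ := by ring

theorem exists_lintegral_lt_top (hM : IsWSS d M) (hL : WSS_L_B d M)
    (h2 : WSS_M2_B d M) (hl : 0 < l) :
    ∃ m, 0 < m ∧ (∫⁻ x : EuclideanSpace ℝ (Fin d),
      ENNReal.ofReal (Real.exp (assocFun d (M l) x - assocFun d (M m) x))) < ⊤ := by
  obtain ⟨m, hm, C, hC, h⟩ := exists_one_add_norm_pow_mul_exp_le hM hL h2 (d + 1) hl
  refine ⟨m, hm, ?_⟩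
  have hfin := finite_integral_one_add_norm (E := EuclideanSpace ℝ (Fin d)) (μ := volume)
    (r := (d + 1 : ℕ)) (by simp)
  refine lt_of_le_of_lt ?_ (ENNReal.mul_lt_top (ENNReal.ofReal_lt_top (r := C)) hfin)
  rw [← lintegral_const_mul' _ _ ENNReal.ofReal_ne_top]
  refine lintegral_mono fun x => ?_
  rw [← ENNReal.ofReal_mul hC.le]
  refine ENNReal.ofReal_le_ofReal ?_
  have hx : 0 < (1 + ‖x‖) ^ (d + 1) := by positivity
  rw [Real.exp_sub, Real.rpow_neg (by positivity), Real.rpow_natCast, ← div_eq_mul_inv,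
    div_le_div_iff₀ (Real.exp_pos _) hx, mul_comm]
  exact h x

/-- An isotropically decomposable system splits off the block containing a given coordinate. -/
theorem IsoDecomposable.exists_block (h : IsoDecomposable d M) (j : Fin d) :
    ∃ B : Finset (Fin d), j ∈ B ∧ ∀ l, 0 < l → ∀ α : Fin d → ℕ,
      M l α * M l 0
        = M l (fun i => if i ∈ B then 0 else α i) * M l (Pi.single j (∑ i ∈ B, α i)) := by
  obtain ⟨k, b, w, -, hw⟩ := h
  refine ⟨Finset.univ.filter fun i => b i = b j, by simp, fun l hl α => ?_⟩
  simp only [hw l hl, ← Finset.prod_mul_distrib]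
  refine Finset.prod_congr rfl fun c _ => ?_
  by_cases hc : c = b j
  · subst hc
    have h1 : ∑ i ∈ Finset.univ.filter (fun i => b i = b j),
        (if i ∈ Finset.univ.filter (fun i => b i = b j) then 0 else α i) = 0 :=
      Finset.sum_eq_zero fun i hi => if_pos hi
    rw [h1, Finset.sum_pi_single']
    simp [mul_comm]
  · have h1 : ∑ i ∈ Finset.univ.filter (fun i => b i = c),
        (if i ∈ Finset.univ.filter (fun i => b i = b j) then 0 else α i)
          = ∑ i ∈ Finset.univ.filter (fun i => b i = c), α i := by
      refine Finset.sum_congr rfl fun i hi => if_neg ?_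
      simp only [Finset.mem_filter, Finset.mem_univ, true_and] at hi ⊢
      rw [hi]; exact hc
    rw [h1, Finset.sum_pi_single']
    simp [Ne.symm hc]

theorem bddAbove_single (hM : IsWSS d M) (hl : 0 < l) (j : Fin d) {t : ℝ} (ht : 0 ≤ t) :
    BddAbove (Set.range fun n : ℕ =>
      t ^ n * M l (Pi.single j 0) / M l (Pi.single j n)) := by
  refine (hM.bddAbove hl (EuclideanSpace.single j t)).mono ?_
  rintro _ ⟨n, rfl⟩
  refine ⟨Pi.single j n, ?_⟩
  rw [assocTerm, Finset.prod_eq_single j (fun i _ hi => by simp [hi]) (by simp)]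
  simp [abs_of_nonneg ht]

theorem seqAssoc_single_le_exp (hM : IsWSS d M) (hl : 0 < l) (j : Fin d)
    {x : EuclideanSpace ℝ (Fin d)} (hx : 0 ≤ x j) :
    seqAssoc (fun n => M l (Pi.single j n)) (x j) ≤ Real.exp (assocFun d (M l) x) := by
  refine ciSup_le fun n => le_trans (le_of_eq ?_)
    (assocTerm_le_exp (hM.pos l hl) (hM.bddAbove hl x) (Pi.single j n))
  rw [assocTerm, Finset.prod_eq_single j (fun i _ hi => by simp [hi]) (by simp)]
  simp [abs_of_nonneg hx]

/-- When `x j` dominates and the other coordinates are at most `1`, the associated function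
at `x` is controlled by its restriction to the `j`-th axis. -/
theorem exists_exp_assocFun_le_seqAssoc (hM : IsWSS d M) (hiso : IsoDecomposable d M)
    (hl : 0 < l) (j : Fin d) :
    ∃ C, 0 < C ∧ ∀ x : EuclideanSpace ℝ (Fin d), 1 ≤ x j → (∀ i, i ≠ j → |x i| ≤ 1) →
      Real.exp (assocFun d (M l) x) ≤ C * seqAssoc (fun n => M l (Pi.single j n)) (x j) := by
  obtain ⟨B, hjB, hB⟩ := hiso.exists_block j
  set e : EuclideanSpace ℝ (Fin d) := WithLp.toLp 2 fun _ => 1 with he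
  refine ⟨Real.exp (assocFun d (M l) e), Real.exp_pos _, fun x hxj hx => ?_⟩
  have hx0 : 0 ≤ x j := by linarith
  have habs : ∀ i, |x i| ≤ x j := fun i => by
    by_cases h : i = j
    · rw [h, abs_of_nonneg hx0]
    · exact (hx i h).trans hxj
  refine exp_assocFun_le (hM.pos l hl) fun α => ?_
  set α' : Fin d → ℕ := fun i => if i ∈ B then 0 else α i with hα'
  set n := ∑ i ∈ B, α i with hn
  have p0 := hM.pos l hl 0
  have p1 := hM.pos l hl α
  have p2 := hM.pos l hl α'
  have p3 := hM.pos l hl (Pi.single j n)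
  have hprod : ∏ i, |x i| ^ α i ≤ x j ^ n := by
    rw [hn, ← Finset.prod_pow_eq_pow_sum, ← Finset.prod_mul_prod_compl B]
    have h1 : ∏ i ∈ B, |x i| ^ α i ≤ ∏ i ∈ B, x j ^ α i :=
      Finset.prod_le_prod (fun i _ => by positivity) fun i _ => by
        gcongr; exact habs i
    have h2 : ∏ i ∈ Bᶜ, |x i| ^ α i ≤ 1 := by
      refine Finset.prod_le_one (fun i _ => by positivity) fun i hi => ?_
      refine pow_le_one₀ (abs_nonneg _) (hx i ?_)
      rintro rfl
      exact (Finset.mem_compl.1 hi) hjB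
    calc _ ≤ (∏ i ∈ B, x j ^ α i) * 1 :=
          mul_le_mul h1 h2 (Finset.prod_nonneg fun i _ => by positivity)
            (Finset.prod_nonneg fun i _ => by positivity)
      _ = _ := mul_one _
  have hsplit : assocTerm d (M l) x α
      = M l 0 / M l α' * ((∏ i, |x i| ^ α i) * M l 0 / M l (Pi.single j n)) := by
    rw [assocTerm, div_mul_div_comm, div_eq_div_iff p1.ne' (by positivity), ← hB l hl α]
    ring
  have he1 : M l 0 / M l α' ≤ Real.exp (assocFun d (M l) e) := by
    have h := assocTerm_le_exp (hM.pos l hl) (hM.bddAbove hl e) α'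
    simpa [assocTerm, he] using h
  rw [hsplit]
  refine mul_le_mul he1 ?_ ?_ (Real.exp_pos _).le
  · refine le_trans ?_ (le_seqAssoc (bddAbove_single hM hl j hx0) n)
    simp only [Pi.single_zero]
    gcongr
  · exact div_nonneg (mul_nonneg (Finset.prod_nonneg fun i _ => by positivity) p0.le) p3.le

theorem volume_toLp_box (j : Fin d) (r : ℝ) :
    MeasurableSet {x : EuclideanSpace ℝ (Fin d) | 1 ≤ x j ∧ x j ≤ r ∧
      ∀ i, i ≠ j → 0 ≤ x i ∧ x i ≤ 1} ∧
    volume {x : EuclideanSpace ℝ (Fin d) | 1 ≤ x j ∧ x j ≤ r ∧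
      ∀ i, i ≠ j → 0 ≤ x i ∧ x i ≤ 1} = ENNReal.ofReal (r - 1) := by
  set a : Fin d → ℝ := Pi.single j 1 with ha
  set b : Fin d → ℝ := Function.update (fun _ => 1) j r with hb
  have hset : {x : EuclideanSpace ℝ (Fin d) | 1 ≤ x j ∧ x j ≤ r ∧
      ∀ i, i ≠ j → 0 ≤ x i ∧ x i ≤ 1}
      = (MeasurableEquiv.toLp 2 (Fin d → ℝ)).symm ⁻¹' Set.Icc a b := by
    ext x
    simp only [Set.mem_ofPred_eq, Set.mem_preimage, Set.mem_Icc, Pi.le_def]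
    change _ ↔ (∀ i, a i ≤ x i) ∧ ∀ i, x i ≤ b i
    constructor
    · rintro ⟨h1, h2, h3⟩
      refine ⟨fun i => ?_, fun i => ?_⟩ <;> by_cases hi : i = j
      · subst hi; simpa [ha] using h1
      · simpa [ha, hi] using (h3 i hi).1
      · subst hi; simpa [hb] using h2
      · simpa [hb, hi] using (h3 i hi).2
    · rintro ⟨h1, h2⟩
      refine ⟨by simpa [ha] using h1 j, by simpa [hb] using h2 j, fun i hi => ?_⟩
      exact ⟨by simpa [ha, hi] using h1 i, by simpa [hb, hi] using h2 i⟩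
  rw [hset]
  refine ⟨(MeasurableEquiv.measurable _) measurableSet_Icc, ?_⟩
  rw [(EuclideanSpace.volume_preserving_symm_measurableEquiv_toLp (Fin d)).measure_preimage
    measurableSet_Icc.nullMeasurableSet, Real.volume_Icc_pi,
    Finset.prod_eq_single j (fun i _ hi => by simp [ha, hb, hi]) (by simp)]
  simp [ha, hb]

theorem exists_mul_seqAssoc_le_of_lintegral_lt_top (hM : IsWSS d M)
    (hiso : IsoDecomposable d M) (hacc : WSSAccel d M) (hm : 0 < m) (hml : m ≤ l)
    (hint : (∫⁻ x : EuclideanSpace ℝ (Fin d),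
      ENNReal.ofReal (Real.exp (assocFun d (M l) x - assocFun d (M m) x))) < ⊤)
    (j : Fin d) :
    ∃ C, 0 < C ∧ ∀ t : ℝ, 0 < t →
      t * seqAssoc (fun n => M l (Pi.single j n)) t
        ≤ C * seqAssoc (fun n => M m (Pi.single j n)) t := by
  have hl := hm.trans_le hml
  have hposl : ∀ n : ℕ, 0 < M l (Pi.single j n) := fun n => hM.pos l hl _
  have hposm : ∀ n : ℕ, 0 < M m (Pi.single j n) := fun n => hM.pos m hm _
  have hratio : ∀ n : ℕ, M m (Pi.single j (n + 1)) / M m (Pi.single j n)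
      ≤ M l (Pi.single j (n + 1)) / M l (Pi.single j n) := fun n => by
    simpa [← Pi.single_add] using hacc m l hm hml (Pi.single j n) j
  obtain ⟨K, hK, hKle⟩ := exists_exp_assocFun_le_seqAssoc hM hiso hm j
  set I := ∫⁻ x : EuclideanSpace ℝ (Fin d),
    ENNReal.ofReal (Real.exp (assocFun d (M l) x - assocFun d (M m) x)) with hI
  set Sl := seqAssoc fun n => M l (Pi.single j n) with hSl
  set Sm := seqAssoc fun n => M m (Pi.single j n) with hSm
  have hSlpos : ∀ t, 0 ≤ t → 0 < Sl t := fun t ht => seqAssoc_pos hposl (bddAbove_single hM hl j ht)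
  have hSmpos : ∀ t, 0 ≤ t → 0 < Sm t := fun t ht => seqAssoc_pos hposm (bddAbove_single hM hm j ht)
  have hlarge : ∀ r, 1 ≤ r → (r - 1) * Sl r ≤ K * I.toReal * Sm r := by
    intro r hr
    have hr0 : 0 < r := by linarith
    have h1 : ENNReal.ofReal (Sl r / (K * Sm r)) * ENNReal.ofReal (r - 1) ≤ I := by
      obtain ⟨hmeas, hvol⟩ := volume_toLp_box (d := d) j r
      rw [← hvol, ← setLIntegral_const]
      refine (setLIntegral_mono' hmeas ?_).trans (setLIntegral_le_lintegral _ _)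
      rintro x ⟨hx1, hxr, hx⟩
      refine ENNReal.ofReal_le_ofReal ?_
      have hx0 : 0 < x j := by linarith
      rw [Real.exp_sub, div_le_div_iff₀ (mul_pos hK (hSmpos r hr0.le)) (Real.exp_pos _)]
      have hxm := hKle x hx1 fun i hi => abs_le.2 ⟨by linarith [(hx i hi).1], (hx i hi).2⟩
      calc Sl r * Real.exp (assocFun d (M m) x) ≤ Sl r * (K * Sm (x j)) :=
            mul_le_mul_of_nonneg_left hxm (hSlpos r hr0.le).le
        _ = K * (Sl r * Sm (x j)) := by ring
        _ ≤ K * (Sl (x j) * Sm r) := by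
            refine mul_le_mul_of_nonneg_left ?_ hK.le
            exact seqAssoc_mul_le_mul hposm hposl hratio hx0 hxr
              (bddAbove_single hM hm j hx0.le) (bddAbove_single hM hm j hr0.le)
              (bddAbove_single hM hl j hx0.le)
        _ = Sl (x j) * (K * Sm r) := by ring
        _ ≤ _ := mul_le_mul_of_nonneg_right (seqAssoc_single_le_exp hM hl j hx0.le)
              (mul_pos hK (hSmpos r hr0.le)).le
    have hq : 0 ≤ Sl r / (K * Sm r) :=
      div_nonneg (hSlpos r hr0.le).le (mul_pos hK (hSmpos r hr0.le)).le
    rw [← ENNReal.ofReal_mul hq, ENNReal.ofReal_le_iff_le_toReal hint.ne, div_mul_eq_mul_div,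
      div_le_iff₀ (mul_pos hK (hSmpos r hr0.le))] at h1
    linarith
  set D := M l (Pi.single j 0) / M m (Pi.single j 0) with hD
  have hDpos : 0 < D := div_pos (hposl 0) (hposm 0)
  have hI0 : 0 ≤ I.toReal := ENNReal.toReal_nonneg
  refine ⟨2 * (K * I.toReal) + 2 * D, by positivity, fun t ht => ?_⟩
  have hSmt := hSmpos t ht.le
  have hSlt := hSlpos t ht.le
  rcases le_total t 2 with h | h
  · have h1 : Sl t ≤ D * Sm t := seqAssoc_le_of_le hposm hposl
      (fun n => hM.mono m l hm hml _) ht.le (bddAbove_single hM hm j ht.le)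
    calc t * Sl t ≤ 2 * (D * Sm t) := by gcongr
      _ ≤ _ := by
        have : 0 ≤ 2 * (K * I.toReal) * Sm t := by positivity
        linarith
  · have h1 := hlarge t (by linarith)
    calc t * Sl t ≤ 2 * (t - 1) * Sl t := by gcongr; linarith
      _ = 2 * ((t - 1) * Sl t) := by ring
      _ ≤ 2 * (K * I.toReal * Sm t) := by gcongr
      _ ≤ _ := by
        have : 0 ≤ 2 * D * Sm t := by positivity
        linarith

theorem exists_single_succ_le_of_lintegral_lt_top (hM : IsWSS d M)
    (hiso : IsoDecomposable d M) (hacc : WSSAccel d M) (hm : 0 < m) (hml : m ≤ l)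
    (hint : (∫⁻ x : EuclideanSpace ℝ (Fin d),
      ENNReal.ofReal (Real.exp (assocFun d (M l) x - assocFun d (M m) x))) < ⊤)
    (j : Fin d) :
    ∃ C, 0 < C ∧ ∀ n : ℕ, M m (Pi.single j (n + 1)) ≤ C * M l (Pi.single j n) := by
  have hl := hm.trans_le hml
  obtain ⟨C, hC, h⟩ := exists_mul_seqAssoc_le_of_lintegral_lt_top hM hiso hacc hm hml hint j
  have h1 := hM.pos m hm (Pi.single j 0)
  have h2 := hM.pos l hl (Pi.single j 0)
  refine ⟨C * M m (Pi.single j 0) / M l (Pi.single j 0), by positivity, ?_⟩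
  refine succ_le_of_mul_seqAssoc_le (a := fun n => M m (Pi.single j n))
    (b := fun n => M l (Pi.single j n)) (fun n => hM.pos m hm _) (fun n => hM.pos l hl _)
    (fun n => ?_) (fun t ht => bddAbove_single hM hl j ht.le) hC.le h
  simpa [← Pi.single_add] using hM.logconvex m hm (Pi.single j n) j

theorem exists_add_single_le_of_lintegral_lt_top (hM : IsWSS d M)
    (hiso : IsoDecomposable d M) (hacc : WSSAccel d M) (hm : 0 < m) (hml : m ≤ l)
    (hint : (∫⁻ x : EuclideanSpace ℝ (Fin d),
      ENNReal.ofReal (Real.exp (assocFun d (M l) x - assocFun d (M m) x))) < ⊤)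
    (j : Fin d) :
    ∃ C, 0 < C ∧ ∀ α : Fin d → ℕ, M m (α + Pi.single j 1) ≤ C * M l α := by
  have hl := hm.trans_le hml
  obtain ⟨C, hC, h⟩ := exists_single_succ_le_of_lintegral_lt_top hM hiso hacc hm hml hint j
  obtain ⟨B, hjB, hB⟩ := hiso.exists_block j
  have p1 := hM.pos m hm 0
  have p2 := hM.pos l hl 0
  refine ⟨C * M l 0 / M m 0, by positivity, fun α => ?_⟩
  have hα' : (fun i => if i ∈ B then 0 else (α + Pi.single j 1 : Fin d → ℕ) i)
      = fun i => if i ∈ B then 0 else α i := by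
    funext i
    by_cases hi : i ∈ B
    · simp [hi]
    · have hij : i ≠ j := fun hij => hi (hij ▸ hjB)
      simp [hi, hij]
  have hsum : ∑ i ∈ B, (α + Pi.single j 1 : Fin d → ℕ) i = ∑ i ∈ B, α i + 1 := by
    simp only [Pi.add_apply, Finset.sum_add_distrib, Finset.sum_pi_single', if_pos hjB]
  have e1 := hB m hm (α + Pi.single j 1)
  rw [hα', hsum] at e1
  have e2 := hB l hl α
  set β : Fin d → ℕ := fun i => if i ∈ B then 0 else α i with hβ
  have p3 := hM.pos l hl β
  have p4 := hM.pos m hm (Pi.single j (∑ i ∈ B, α i + 1))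
  rw [div_mul_eq_mul_div, le_div_iff₀ p1, e1]
  calc _ ≤ M l β * (C * M l (Pi.single j (∑ i ∈ B, α i))) := by
        gcongr
        · exact hM.mono m l hm hml β
        · exact h _
    _ = C * (M l β * M l (Pi.single j (∑ i ∈ B, α i))) := by ring
    _ = _ := by rw [← e2]; ring

theorem lintegral_min_lt_top (hM : IsWSS d M) (hl : 0 < l) (hm : 0 < m)
    (hint : (∫⁻ x : EuclideanSpace ℝ (Fin d),
      ENNReal.ofReal (Real.exp (assocFun d (M l) x - assocFun d (M m) x))) < ⊤) :
    (∫⁻ x : EuclideanSpace ℝ (Fin d),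
      ENNReal.ofReal (Real.exp (assocFun d (M l) x - assocFun d (M (min m l)) x))) < ⊤ := by
  have hn : 0 < min m l := lt_min hm hl
  have p1 := hM.pos m hm 0
  have p2 := hM.pos _ hn 0
  have hD : 0 < M m 0 / M (min m l) 0 := div_pos p1 p2
  refine lt_of_le_of_lt ?_ (ENNReal.mul_lt_top
    (ENNReal.ofReal_lt_top (r := M m 0 / M (min m l) 0)) hint)
  rw [← lintegral_const_mul' _ _ ENNReal.ofReal_ne_top]
  refine lintegral_mono fun x => ?_
  rw [← ENNReal.ofReal_mul hD.le]
  refine ENNReal.ofReal_le_ofReal ?_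
  have h := exp_assocFun_le_of_le hM hn (min_le_left m l) x
  rw [Real.exp_sub, Real.exp_sub, mul_div_assoc', div_le_div_iff₀ (Real.exp_pos _) (Real.exp_pos _)]
  calc _ ≤ Real.exp (assocFun d (M l) x)
        * (M m 0 / M (min m l) 0 * Real.exp (assocFun d (M (min m l)) x)) := by gcongr
    _ = _ := by ring

end System

/-- For an isotropically decomposable accelerating weight sequence system `𝔐` satisfying (L),
condition (𝔐.2)' holds iff for every `λ > 0` there is `μ > 0` with
`∫ exp(ω_{M^λ}(x) − ω_{M^μ}(x)) dx < ∞`. -/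
theorem stmt3 (d : ℕ) (M : ℝ → (Fin d → ℕ) → ℝ)
    (hM : IsWSS d M) (hL : WSS_L_B d M) (hiso : IsoDecomposable d M)
    (hacc : WSSAccel d M) :
    WSS_M2_B d M ↔
      ∀ l, 0 < l → ∃ m, 0 < m ∧
        (∫⁻ x : EuclideanSpace ℝ (Fin d),
          ENNReal.ofReal (Real.exp (assocFun d (M l) x - assocFun d (M m) x))) < ⊤ := by
  refine ⟨fun h2 l hl => exists_lintegral_lt_top hM hL h2 hl, fun h l hl => ?_⟩
  obtain ⟨m, hm, hint⟩ := h l hl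
  have hn : 0 < min m l := lt_min hm hl
  choose C hC hCle using exists_add_single_le_of_lintegral_lt_top hM hiso hacc hn
    (min_le_right m l) (lintegral_min_lt_top hM hl hm hint)
  refine ⟨min m l, hn, 1 + ∑ j, C j, ?_, 1, one_pos, fun α j => ?_⟩
  · have : 0 ≤ ∑ j, C j := Finset.sum_nonneg fun j _ => (hC j).le
    linarith
  · have h1 : C j ≤ ∑ j, C j :=
      Finset.single_le_sum (fun i _ => (hC i).le) (Finset.mem_univ j)
    have hα := hM.pos l hl α
    rw [one_pow, mul_one]
    exact (hCle j α).trans (by gcongr; linarith)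
end

section
/- Let 𝔐 = (M^λ)_{λ>0} be a weight sequence system and 𝒲 = (w^λ)_{λ>0} a weight function system on ℝ^d satisfying (M), and let q ∈ [1,∞]. Let ψ ∈ 𝒮̃^{(𝔐)}_{(𝒲)}. Then for every λ > 0 there exist μ > 0 and C > 0 such that: for every family (c_j)_{j∈ℤ^d} of complex numbers with ‖(c_j w^μ(j))_{j∈ℤ^d}‖_{ℓ^q} < ∞, the series ∑_{j∈ℤ^d} c_j ∂^α ψ(x−j) converges absolutely for every x ∈ ℝ^d and every multi-index α, its sum for α = 0 defines a smooth function φ with ∂^α φ(x) = ∑_j c_j ∂^α ψ(x−j), and ‖φ‖_{𝒮^{M^λ}_{w^λ,q}} ≤ C · ‖(c_j w^μ(j))_{j∈ℤ^d}‖_{ℓ^q}. -/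
open MeasureTheory Filter ENNReal Asymptotics

section Schur

/-- **Schur's test** for a nonnegative kernel from a countable discrete space: if all row sums and
all column integrals are at most `K`, the operator has norm at most `K` from `ℓ^q` to `L^q`. -/
theorem eLpNorm_tsum_mul_le_of_schur {ι X : Type*} [MeasurableSpace ι] [Countable ι]
    [MeasurableSingletonClass ι] [MeasurableSpace X] {μ : Measure X} (k : ι → X → ℝ≥0∞)
    (hk : ∀ i, Measurable (k i)) {K : ℝ≥0∞} (hrow : ∀ x, ∑' i, k i x ≤ K)
    (hcol : ∀ i, ∫⁻ x, k i x ∂μ ≤ K) {q : ℝ≥0∞} (hq : 1 ≤ q) (a : ι → ℝ≥0∞) :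
    eLpNorm (fun x => ∑' i, a i * k i x) q μ ≤ K * eLpNorm a q Measure.count := by
  have hq0 : q ≠ 0 := (zero_lt_one.trans_le hq).ne'
  rcases eq_or_ne q ∞ with rfl | hqt
  · rw [eLpNorm_exponent_top]
    refine eLpNormEssSup_le_of_ae_enorm_bound (ae_of_all _ fun x => ?_)
    calc ‖∑' i, a i * k i x‖ₑ ≤ ∑' i, eLpNorm a ∞ Measure.count * k i x := by
          rw [enorm_eq_self]
          gcongr with i
          exact enorm_le_eLpNorm_count a i hq0
      _ ≤ K * eLpNorm a ∞ Measure.count := by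
          rw [ENNReal.tsum_mul_left, mul_comm]
          gcongr
          exact hrow x
  have hp1 : 1 ≤ q.toReal := by
    simpa using (ENNReal.toReal_le_toReal one_ne_top hqt).2 hq
  have hp0 : 0 < q.toReal := zero_lt_one.trans_le hp1
  have key : ∀ x, (∑' i, a i * k i x) ^ q.toReal ≤
      K ^ (q.toReal - 1) * ∑' i, a i ^ q.toReal * k i x := by
    intro x
    rcases hp1.eq_or_lt with h1 | h1
    · simp [← h1]
    have hpq := Real.HolderConjugate.conjExponent h1
    set p := q.toReal
    set p' := p.conjExponent
    have hinv : 1 / p + 1 / p' = 1 := by simpa using hpq.inv_add_inv_eq_one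
    have hp'0 : 0 < p' := hpq.symm.pos
    have hH := ENNReal.lintegral_mul_le_Lp_mul_Lq (Measure.count : Measure ι) hpq
      (f := fun i => a i * k i x ^ (1 / p)) (g := fun i => k i x ^ (1 / p'))
      (measurable_of_countable _).aemeasurable (measurable_of_countable _).aemeasurable
    simp only [lintegral_count, Pi.mul_apply] at hH
    have e1 : ∀ i, a i * k i x ^ (1 / p) * k i x ^ (1 / p') = a i * k i x := fun i => by
      rw [mul_assoc, ← ENNReal.rpow_add_of_nonneg _ _ (by positivity) (by positivity), hinv,
        ENNReal.rpow_one]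
    have e2 : ∀ i, (a i * k i x ^ (1 / p)) ^ p = a i ^ p * k i x := fun i => by
      rw [ENNReal.mul_rpow_of_nonneg _ _ hp0.le, ← ENNReal.rpow_mul, one_div_mul_cancel hp0.ne',
        ENNReal.rpow_one]
    have e3 : ∀ i, (k i x ^ (1 / p')) ^ p' = k i x := fun i => by
      rw [← ENNReal.rpow_mul, one_div_mul_cancel hp'0.ne', ENNReal.rpow_one]
    simp only [e1, e2, e3] at hH
    calc (∑' i, a i * k i x) ^ p
        ≤ ((∑' i, a i ^ p * k i x) ^ (1 / p) * K ^ (1 / p')) ^ p := by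
          gcongr
          refine hH.trans ?_
          gcongr
          exact hrow x
      _ = K ^ (p - 1) * ∑' i, a i ^ p * k i x := by
          rw [ENNReal.mul_rpow_of_nonneg _ _ hp0.le, ← ENNReal.rpow_mul, ← ENNReal.rpow_mul,
            one_div_mul_cancel hp0.ne', ENNReal.rpow_one, mul_comm]
          congr 2
          have : 1 / p' = 1 - 1 / p := by linarith
          rw [this]
          field_simp
  have hint : ∫⁻ x, (∑' i, a i * k i x) ^ q.toReal ∂μ ≤
      K ^ q.toReal * ∑' i, a i ^ q.toReal := by
    calc ∫⁻ x, (∑' i, a i * k i x) ^ q.toReal ∂μ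
        ≤ ∫⁻ x, K ^ (q.toReal - 1) * ∑' i, a i ^ q.toReal * k i x ∂μ := lintegral_mono key
      _ = K ^ (q.toReal - 1) * ∑' i, a i ^ q.toReal * ∫⁻ x, k i x ∂μ := by
          rw [lintegral_const_mul _ (Measurable.tsum fun i => (hk i).const_mul _),
            lintegral_tsum fun i => ((hk i).const_mul _).aemeasurable]
          simp_rw [lintegral_const_mul _ (hk _)]
      _ ≤ K ^ (q.toReal - 1) * ∑' i, a i ^ q.toReal * K := by
          gcongr with i
          exact hcol i
      _ = K ^ q.toReal * ∑' i, a i ^ q.toReal := by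
          rw [ENNReal.tsum_mul_right, mul_comm _ K, ← mul_assoc]
          congr 1
          nth_rewrite 2 [← ENNReal.rpow_one K]
          rw [← ENNReal.rpow_add_of_nonneg _ _ (by linarith) zero_le_one, sub_add_cancel]
  rw [eLpNorm_eq_lintegral_rpow_enorm_toReal hq0 hqt,
    eLpNorm_eq_lintegral_rpow_enorm_toReal hq0 hqt, lintegral_count]
  simp only [enorm_eq_self]
  calc (∫⁻ x, (∑' i, a i * k i x) ^ q.toReal ∂μ) ^ (1 / q.toReal)
      ≤ (K ^ q.toReal * ∑' i, a i ^ q.toReal) ^ (1 / q.toReal) := by gcongr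
    _ = K * (∑' i, a i ^ q.toReal) ^ (1 / q.toReal) := by
        rw [ENNReal.mul_rpow_of_nonneg _ _ (by positivity), ← ENNReal.rpow_mul,
          mul_one_div_cancel hp0.ne', ENNReal.rpow_one]

end Schur

section Decay

theorem summable_inv_norm_pow_of_injective {E : Type*} [NormedAddCommGroup E] [NormedSpace ℝ E]
    [FiniteDimensional ℝ E] {ι : Type*} (L : Submodule ℤ E) [DiscreteTopology L] [IsZLattice ℝ L]
    {f : ι → E} (hf : Function.Injective f) (hL : ∀ j, f j ∈ L) {n : ℕ}
    (hn : Module.finrank ℝ E < n) : Summable fun j => ‖f j‖⁻¹ ^ n :=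
  (ZLattice.summable_norm_pow_inv L n ((ZLattice.rank ℝ L).trans_lt hn)).comp_injective
    (i := fun j => (⟨f j, hL j⟩ : L)) fun _ _ h => hf (congrArg Subtype.val h)

/-- The integrable weight `(1 + ‖x‖)^{-(d+1)}` on `ℝ^d`. -/
noncomputable def decay (d : ℕ) (x : EuclideanSpace ℝ (Fin d)) : ℝ := ((1 + ‖x‖) ^ (d + 1))⁻¹

variable {d : ℕ}

theorem decay_pos (x : EuclideanSpace ℝ (Fin d)) : 0 < decay d x := by
  unfold decay; positivity

theorem decay_neg (x : EuclideanSpace ℝ (Fin d)) : decay d (-x) = decay d x := by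
  simp [decay]

theorem continuous_decay : Continuous (decay d) := by
  unfold decay
  exact Continuous.inv₀ (by fun_prop) fun x => by positivity

theorem decay_add_le (x y : EuclideanSpace ℝ (Fin d)) :
    decay d (x + y) ≤ (1 + ‖y‖) ^ (d + 1) * decay d x := by
  unfold decay
  rw [← div_eq_mul_inv, inv_eq_one_div, div_le_div_iff₀ (by positivity) (by positivity), one_mul,
    ← mul_pow]
  gcongr
  have : ‖x‖ ≤ ‖x + y‖ + ‖y‖ := by simpa using norm_sub_le (x + y) y
  nlinarith [norm_nonneg y, norm_nonneg (x + y)]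

theorem intPt_apply (j : Fin d → ℤ) (i : Fin d) : intPt d j i = j i := rfl

theorem intPt_sub (j k : Fin d → ℤ) : intPt d (j - k) = intPt d j - intPt d k := by
  ext i; simp [intPt_apply]

theorem intPt_injective : Function.Injective (intPt d) := fun j k h => by
  ext i
  simpa [intPt_apply] using congrArg (fun v : EuclideanSpace ℝ (Fin d) => v i) h

theorem intPt_mem_span (j : Fin d → ℤ) :
    intPt d j ∈ Submodule.span ℤ (Set.range (EuclideanSpace.basisFun (Fin d) ℝ).toBasis) := by
  rw [Module.Basis.mem_span_iff_repr_mem]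
  intro i
  exact ⟨j i, by simp [intPt_apply]⟩

theorem summable_decay_intPt : Summable fun j : Fin d → ℤ => decay d (intPt d j) := by
  have h1 : Summable fun j : Fin d → ℤ => ‖intPt d j‖⁻¹ ^ (d + 1) :=
    summable_inv_norm_pow_of_injective _ intPt_injective intPt_mem_span (by simp)
  have h2 : Summable fun j : Fin d → ℤ => if j = 0 then (1 : ℝ) else 0 :=
    (hasSum_ite_eq 0 1).summable
  refine (h1.add h2).of_nonneg_of_le (fun j => (decay_pos _).le) fun j => ?_
  have h0 : (0 : ℝ) ≤ ‖intPt d j‖⁻¹ ^ (d + 1) := by positivity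
  split_ifs with hj
  · have : decay d (intPt d j) ≤ 1 := inv_le_one_of_one_le₀ (one_le_pow₀ (by simp))
    linarith
  · have hne : intPt d j ≠ 0 := fun h => hj (intPt_injective
        (h.trans (by ext i; simp [intPt_apply])))
    have := norm_pos_iff.2 hne
    rw [add_zero, decay, inv_pow]
    gcongr
    simp

theorem decay_sub_intPt_le (x : EuclideanSpace ℝ (Fin d)) (j : Fin d → ℤ) :
    decay d (x - intPt d j) ≤ (1 + ‖x‖) ^ (d + 1) * decay d (intPt d j) := by
  rw [← decay_neg (intPt d j), sub_eq_neg_add]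
  exact decay_add_le _ _

theorem summable_decay_sub_intPt (x : EuclideanSpace ℝ (Fin d)) :
    Summable fun j : Fin d → ℤ => decay d (x - intPt d j) :=
  (summable_decay_intPt.mul_left _).of_nonneg_of_le (fun _ => (decay_pos _).le)
    (decay_sub_intPt_le x)

theorem exists_tsum_decay_sub_intPt_le :
    ∃ S : ℝ, ∀ x : EuclideanSpace ℝ (Fin d), ∑' j : Fin d → ℤ, decay d (x - intPt d j) ≤ S := by
  refine ⟨(1 + √d) ^ (d + 1) * ∑' j : Fin d → ℤ, decay d (intPt d j), fun x => ?_⟩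
  let n : Fin d → ℤ := fun i => ⌊x i⌋
  have hn : ‖x - intPt d n‖ ≤ √d := by
    rw [EuclideanSpace.norm_eq]
    apply Real.sqrt_le_sqrt
    calc ∑ i, ‖(x - intPt d n) i‖ ^ 2 ≤ ∑ i : Fin d, (1 : ℝ) := by
          gcongr with i
          have h0 := Int.fract_nonneg (x i)
          have h1 := Int.fract_lt_one (x i)
          have : (x - intPt d n) i = Int.fract (x i) := rfl
          rw [this, Real.norm_eq_abs, sq_abs]
          nlinarith
      _ = d := by simp
  have hb : ∀ j : Fin d → ℤ,
      decay d (x - intPt d j) ≤ (1 + √d) ^ (d + 1) * decay d (intPt d (n - j)) := fun j => by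
    have h := decay_add_le (intPt d (n - j)) (x - intPt d n)
    rw [intPt_sub] at h ⊢
    rw [show intPt d n - intPt d j + (x - intPt d n) = x - intPt d j by abel] at h
    refine h.trans ?_
    have := (decay_pos (intPt d n - intPt d j)).le
    gcongr
  have hs : Summable fun j : Fin d → ℤ => decay d (intPt d (n - j)) :=
    summable_decay_intPt.comp_injective (sub_right_injective (b := n))
  calc ∑' j : Fin d → ℤ, decay d (x - intPt d j)
      ≤ ∑' j : Fin d → ℤ, (1 + √d) ^ (d + 1) * decay d (intPt d (n - j)) :=
        (summable_decay_sub_intPt x).tsum_le_tsum hb (hs.mul_left _)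
    _ = _ := by
        rw [tsum_mul_left]
        congr 1
        exact (Equiv.subLeft n).tsum_eq fun j => decay d (intPt d j)

theorem lintegral_decay_lt_top :
    ∫⁻ x : EuclideanSpace ℝ (Fin d), ENNReal.ofReal (decay d x) < ∞ := by
  have h := finite_integral_one_add_norm (E := EuclideanSpace ℝ (Fin d)) (μ := volume)
    (r := (d + 1 : ℕ)) (by simp)
  refine lt_of_eq_of_lt (lintegral_congr fun x => ?_) h
  rw [decay, Real.rpow_neg (by positivity), Real.rpow_natCast]

/-- Semi-discrete convolution with the integrable weight is bounded from `ℓ^q` to `L^q`. -/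
theorem exists_eLpNorm_tsum_decay_le (d : ℕ) :
    ∃ K : ℝ, 0 < K ∧ ∀ (q : ℝ≥0∞), 1 ≤ q → ∀ a : (Fin d → ℤ) → ℝ≥0∞,
      eLpNorm (fun x => ∑' j, a j * ENNReal.ofReal (decay d (x - intPt d j))) q volume ≤
        ENNReal.ofReal K * eLpNorm a q Measure.count := by
  obtain ⟨S, hS⟩ := exists_tsum_decay_sub_intPt_le (d := d)
  let I := ∫⁻ x : EuclideanSpace ℝ (Fin d), ENNReal.ofReal (decay d x)
  refine ⟨max (max S I.toReal) 1, by positivity, fun q hq a =>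
    eLpNorm_tsum_mul_le_of_schur (fun j x => ENNReal.ofReal (decay d (x - intPt d j)))
      (fun j => ?_) (fun x => ?_) (fun j => ?_) hq a⟩
  · exact (continuous_decay.comp (continuous_id.sub continuous_const)).measurable.ennreal_ofReal
  · rw [← ENNReal.ofReal_tsum_of_nonneg (fun j => (decay_pos _).le) (summable_decay_sub_intPt x)]
    exact ENNReal.ofReal_le_ofReal ((hS x).trans (by simp))
  · rw [lintegral_sub_right_eq_self (fun x => ENNReal.ofReal (decay d x)) (intPt d j)]
    rw [← ENNReal.ofReal_toReal lintegral_decay_lt_top.ne]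
    exact ENNReal.ofReal_le_ofReal (by simp [I])

end Decay

section PartialDerivatives

variable {d : ℕ} {f : EuclideanSpace ℝ (Fin d) → ℂ}

theorem ContDiff.pd (hf : ContDiff ℝ (⊤ : ℕ∞) f) (i : Fin d) : ContDiff ℝ (⊤ : ℕ∞) (pd d i f) :=
  (hf.fderiv_right (m := (⊤ : ℕ∞)) (by simp)).clm_apply contDiff_const

theorem ContDiff.pdPow (hf : ContDiff ℝ (⊤ : ℕ∞) f) (i : Fin d) (n : ℕ) :
    ContDiff ℝ (⊤ : ℕ∞) (pdPow d i n f) := by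
  induction n with
  | zero => exact hf
  | succ n ih => exact ih.pd i

theorem pd_comm (hf : ContDiff ℝ (⊤ : ℕ∞) f) (i k : Fin d) :
    pd d i (pd d k f) = pd d k (pd d i f) := by
  have hd : Differentiable ℝ (fderiv ℝ f) :=
    (hf.fderiv_right (m := (⊤ : ℕ∞)) (by simp)).differentiable (by simp)
  have h : ∀ (k i : Fin d) x, pd d i (pd d k f) x =
      fderiv ℝ (fderiv ℝ f) x (EuclideanSpace.single i 1) (EuclideanSpace.single k 1) := by
    intro k i x
    change fderiv ℝ (fun y => fderiv ℝ f y (EuclideanSpace.single k 1)) x _ = _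
    rw [fderiv_clm_apply (hd x) (differentiableAt_const _)]
    simp
  ext x
  rw [h, h]
  exact (contDiff_infty.1 hf 2).contDiffAt.isSymmSndFDerivAt (by simp) _ _

theorem pd_pdPow_comm (hf : ContDiff ℝ (⊤ : ℕ∞) f) (i k : Fin d) (n : ℕ) :
    pd d i (pdPow d k n f) = pdPow d k n (pd d i f) := by
  induction n with
  | zero => rfl
  | succ n ih => rw [pdPow, pdPow, pd_comm (hf.pdPow k n), ih]

theorem ContDiff.foldr_pdPow (hf : ContDiff ℝ (⊤ : ℕ∞) f) (α : Fin d → ℕ) (s : List (Fin d)) :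
    ContDiff ℝ (⊤ : ℕ∞) (s.foldr (fun i g => _root_.pdPow d i (α i) g) f) := by
  induction s with
  | nil => exact hf
  | cons k s ih => exact ih.pdPow k _

theorem foldr_pdPow_add_single_of_notMem (α : Fin d → ℕ) {i : Fin d} {s : List (Fin d)}
    (his : i ∉ s) :
    s.foldr (fun k g => pdPow d k ((α + Pi.single i 1 : Fin d → ℕ) k) g) f =
      s.foldr (fun k g => pdPow d k (α k) g) f := by
  induction s with
  | nil => rfl
  | cons k s ih =>
    rw [List.mem_cons, not_or] at his
    simp only [List.foldr_cons]
    rw [ih his.2]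
    simp [Pi.single_eq_of_ne (Ne.symm his.1)]

theorem pd_foldr_pdPow (hf : ContDiff ℝ (⊤ : ℕ∞) f) (α : Fin d → ℕ) {i : Fin d}
    {s : List (Fin d)} (hs : s.Nodup) (his : i ∈ s) :
    pd d i (s.foldr (fun k g => pdPow d k (α k) g) f) =
      s.foldr (fun k g => pdPow d k ((α + Pi.single i 1 : Fin d → ℕ) k) g) f := by
  induction s with
  | nil => simp at his
  | cons k s ih =>
    rw [List.nodup_cons] at hs
    simp only [List.foldr_cons]
    rcases eq_or_ne i k with rfl | hik
    · rw [foldr_pdPow_add_single_of_notMem α hs.1]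
      simp [pdPow]
    · rw [pd_pdPow_comm (hf.foldr_pdPow α s), ih hs.2 ((List.mem_cons.1 his).resolve_left hik)]
      simp [Pi.single_eq_of_ne (Ne.symm hik)]

theorem pd_pdMulti (hf : ContDiff ℝ (⊤ : ℕ∞) f) (α : Fin d → ℕ) (i : Fin d) :
    pd d i (pdMulti d α f) = pdMulti d (α + Pi.single i 1) f :=
  pd_foldr_pdPow hf α (List.nodup_finRange d) (List.mem_finRange i)

theorem pdMulti_zero : pdMulti d 0 f = f := by
  unfold pdMulti
  induction List.finRange d with
  | nil => rfl
  | cons k s ih => exact ih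

theorem exists_foldr_pd_eq_pdMulti (hf : ContDiff ℝ (⊤ : ℕ∞) f) (s : List (Fin d)) :
    ∃ α, s.foldr (pd d) f = pdMulti d α f := by
  induction s with
  | nil => exact ⟨0, pdMulti_zero.symm⟩
  | cons i s ih =>
    obtain ⟨α, hα⟩ := ih
    exact ⟨α + Pi.single i 1, by rw [List.foldr_cons, hα, pd_pdMulti hf]⟩

theorem clm_apply_eq_sum (A : EuclideanSpace ℝ (Fin d) →L[ℝ] ℂ) (v : EuclideanSpace ℝ (Fin d)) :
    A v = ∑ i, v i • A (EuclideanSpace.single i 1) := by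
  conv_lhs => rw [← (EuclideanSpace.basisFun (Fin d) ℝ).sum_repr v]
  simp

theorem norm_fderiv_le_sum_norm_pd (x : EuclideanSpace ℝ (Fin d)) :
    ‖fderiv ℝ f x‖ ≤ ∑ i, ‖pd d i f x‖ := by
  refine ContinuousLinearMap.opNorm_le_bound _ (by positivity) fun v => ?_
  rw [clm_apply_eq_sum, Finset.sum_mul]
  refine (norm_sum_le _ _).trans (Finset.sum_le_sum fun i _ => ?_)
  rw [norm_smul, mul_comm]
  exact mul_le_mul_of_nonneg_left (PiLp.norm_apply_le v i) (norm_nonneg _)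

theorem fderiv_eq_sum_pd_smul :
    fderiv ℝ f = fun x => ∑ i, (EuclideanSpace.proj (𝕜 := ℝ) i).smulRight (pd d i f x) := by
  ext x v
  simp [clm_apply_eq_sum (fderiv ℝ f x) v, pd]

end PartialDerivatives

section Synthesis

variable {d : ℕ} {f : EuclideanSpace ℝ (Fin d) → ℂ} {c : (Fin d → ℤ) → ℂ}

/-- Smooth functions all of whose iterated partial derivatives are `O((1 + ‖x‖)^{-(d+1)})`. -/
structure DecaysSmoothly (d : ℕ) (f : EuclideanSpace ℝ (Fin d) → ℂ) : Prop where
  contDiff : ContDiff ℝ (⊤ : ℕ∞) f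
  bound : ∀ s : List (Fin d), ∃ B, ∀ x, ‖s.foldr (_root_.pd d) f x‖ ≤ B * decay d x

theorem DecaysSmoothly.pd (hf : DecaysSmoothly d f) (i : Fin d) : DecaysSmoothly d (pd d i f) where
  contDiff := hf.contDiff.pd i
  bound s := by
    obtain ⟨B, hB⟩ := hf.bound (s ++ [i])
    exact ⟨B, fun x => by simpa using hB x⟩

theorem DecaysSmoothly.pdPow (hf : DecaysSmoothly d f) (i : Fin d) (n : ℕ) :
    DecaysSmoothly d (pdPow d i n f) := by
  induction n with
  | zero => exact hf
  | succ n ih => exact ih.pd i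

theorem DecaysSmoothly.foldr_pdPow (hf : DecaysSmoothly d f) (α : Fin d → ℕ)
    (s : List (Fin d)) :
    DecaysSmoothly d (s.foldr (fun i g => _root_.pdPow d i (α i) g) f) := by
  induction s with
  | nil => exact hf
  | cons k s ih => exact ih.pdPow k _

theorem DecaysSmoothly.summable (hf : DecaysSmoothly d f) {N : ℝ} (hc : ∀ j, ‖c j‖ ≤ N)
    (x : EuclideanSpace ℝ (Fin d)) : Summable fun j => ‖c j‖ * ‖f (x - intPt d j)‖ := by
  obtain ⟨B, hB⟩ := hf.bound []
  refine ((summable_decay_sub_intPt x).mul_left (N * B)).of_nonneg_of_le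
    (fun j => by positivity) fun j => ?_
  rw [mul_assoc]
  exact mul_le_mul (hc j) (hB _) (norm_nonneg _) ((norm_nonneg _).trans (hc j))

/-- The synthesis operator `f ↦ ∑_j c_j f(· - j)`. -/
noncomputable def synth (d : ℕ) (c : (Fin d → ℤ) → ℂ) (f : EuclideanSpace ℝ (Fin d) → ℂ) :
    EuclideanSpace ℝ (Fin d) → ℂ :=
  fun x => ∑' j : Fin d → ℤ, c j * f (x - intPt d j)

theorem DecaysSmoothly.exists_summable_fderiv_bound (hf : DecaysSmoothly d f) {N : ℝ}
    (hc : ∀ j, ‖c j‖ ≤ N) (R : ℝ) :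
    ∃ u : (Fin d → ℤ) → ℝ, Summable u ∧
      ∀ j, ∀ x, ‖x‖ < R → ‖c j • fderiv ℝ f (x - intPt d j)‖ ≤ u j := by
  choose B hB using fun i : Fin d => hf.bound [i]
  refine ⟨fun j => N * ((∑ i, B i) * ((1 + R) ^ (d + 1) * decay d (intPt d j))),
    ((summable_decay_intPt.mul_left _).mul_left _).mul_left _, fun j x hx => ?_⟩
  have hN : 0 ≤ N := (norm_nonneg _).trans (hc j)
  have hB0 : ∀ i, 0 ≤ B i := fun i =>
    nonneg_of_mul_nonneg_left ((norm_nonneg _).trans (hB i 0)) (decay_pos 0)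
  have hS : 0 ≤ ∑ i, B i := Finset.sum_nonneg fun i _ => hB0 i
  rw [norm_smul]
  refine mul_le_mul (hc j) ?_ (norm_nonneg _) hN
  calc ‖fderiv ℝ f (x - intPt d j)‖ ≤ ∑ i, ‖_root_.pd d i f (x - intPt d j)‖ :=
        norm_fderiv_le_sum_norm_pd _
    _ ≤ ∑ i, B i * decay d (x - intPt d j) := Finset.sum_le_sum fun i _ => hB i _
    _ = (∑ i, B i) * decay d (x - intPt d j) := by rw [Finset.sum_mul]
    _ ≤ (∑ i, B i) * ((1 + R) ^ (d + 1) * decay d (intPt d j)) := by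
        gcongr
        refine (decay_sub_intPt_le x j).trans ?_
        have := (decay_pos (intPt d j)).le
        gcongr

theorem DecaysSmoothly.hasFDerivAt_synth (hf : DecaysSmoothly d f) {N : ℝ}
    (hc : ∀ j, ‖c j‖ ≤ N) (x : EuclideanSpace ℝ (Fin d)) :
    HasFDerivAt (synth d c f) (∑' j, c j • fderiv ℝ f (x - intPt d j)) x := by
  obtain ⟨u, hu, hbound⟩ := hf.exists_summable_fderiv_bound hc (‖x‖ + 1)
  have hx : x ∈ Metric.ball (0 : EuclideanSpace ℝ (Fin d)) (‖x‖ + 1) := by simp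
  refine hasFDerivAt_tsum_of_isPreconnected hu Metric.isOpen_ball
    (convex_ball _ _).isPreconnected (fun j y _ => ?_)
    (fun j y hy => hbound j y (by simpa using hy)) hx ?_ hx
  · have h := (hf.contDiff.differentiable (by simp) (y - intPt d j)).hasFDerivAt
    exact ((hasFDerivAt_comp_sub _).2 h).const_smul (c j)
  · exact .of_norm (by simpa using hf.summable hc x)

theorem DecaysSmoothly.pd_synth (hf : DecaysSmoothly d f) {N : ℝ} (hc : ∀ j, ‖c j‖ ≤ N)
    (i : Fin d) : _root_.pd d i (synth d c f) = synth d c (_root_.pd d i f) := by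
  ext x
  obtain ⟨u, hu, hbound⟩ := hf.exists_summable_fderiv_bound hc (‖x‖ + 1)
  have hs : Summable fun j => c j • fderiv ℝ f (x - intPt d j) :=
    .of_norm_bounded hu fun j => hbound j x (by simp)
  rw [_root_.pd, (hf.hasFDerivAt_synth hc x).fderiv]
  exact (ContinuousLinearMap.apply ℝ ℂ (EuclideanSpace.single i (1 : ℝ))).map_tsum hs

theorem DecaysSmoothly.contDiff_synth (hf : DecaysSmoothly d f) {N : ℝ} (hc : ∀ j, ‖c j‖ ≤ N) :
    ContDiff ℝ (⊤ : ℕ∞) (synth d c f) := by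
  refine contDiff_infty.2 fun n => ?_
  induction n generalizing f with
  | zero =>
    exact contDiff_zero.2
      (continuous_iff_continuousAt.2 fun x => (hf.hasFDerivAt_synth hc x).continuousAt)
  | succ n ih =>
    rw [Nat.cast_succ, contDiff_succ_iff_fderiv]
    refine ⟨fun x => (hf.hasFDerivAt_synth hc x).differentiableAt, by simp, ?_⟩
    rw [fderiv_eq_sum_pd_smul]
    refine ContDiff.sum fun i _ => ?_
    rw [hf.pd_synth hc]
    exact contDiff_const.smulRight (ih (hf.pd i))

theorem DecaysSmoothly.pdPow_synth (hf : DecaysSmoothly d f) {N : ℝ} (hc : ∀ j, ‖c j‖ ≤ N)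
    (i : Fin d) (n : ℕ) :
    _root_.pdPow d i n (synth d c f) = synth d c (_root_.pdPow d i n f) := by
  induction n with
  | zero => rfl
  | succ n ih => rw [_root_.pdPow, ih, (hf.pdPow i n).pd_synth hc, _root_.pdPow]

theorem DecaysSmoothly.pdMulti_synth (hf : DecaysSmoothly d f) {N : ℝ} (hc : ∀ j, ‖c j‖ ≤ N)
    (α : Fin d → ℕ) : pdMulti d α (synth d c f) = synth d c (pdMulti d α f) := by
  unfold pdMulti
  induction List.finRange d with
  | nil => rfl
  | cons k s ih =>
    rw [List.foldr_cons, ih, (hf.foldr_pdPow α s).pdPow_synth hc, List.foldr_cons]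

end Synthesis

section GelfandShilov

variable {d : ℕ} {M : ℝ → (Fin d → ℕ) → ℝ} {w : ℝ → EuclideanSpace ℝ (Fin d) → ℝ}
  {ψ : EuclideanSpace ℝ (Fin d) → ℂ}

theorem gsTilde.exists_mul_le (hM : IsWSS d M) (hW : IsWFS d w) (hψ : gsTilde d M w ψ)
    {l n : ℝ} (hl : 0 < l) (hn : 0 < n) :
    ∃ A, 0 < A ∧ ∀ α x, ‖pdMulti d α ψ x‖ * w n x ≤ A * M l α * decay d x := by
  have hln : 0 < min l n := lt_min hl hn
  obtain ⟨C, hC⟩ := hψ.2 (min l n) hln (d + 1)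
  refine ⟨max C 1, by positivity, fun α x => ?_⟩
  have h1 := hC α x
  rw [div_le_iff₀ (hM.pos _ hln α)] at h1
  have h2 := hW.mono _ n hln (min_le_right l n) x
  have h3 := hM.mono _ l hln (min_le_left l n) α
  have h4 := (hM.pos _ hln α).le
  rw [decay, ← div_eq_mul_inv, le_div_iff₀ (by positivity)]
  calc ‖pdMulti d α ψ x‖ * w n x * (1 + ‖x‖) ^ (d + 1)
      = ‖pdMulti d α ψ x‖ * (1 + ‖x‖) ^ (d + 1) * w n x := by ring
    _ ≤ ‖pdMulti d α ψ x‖ * (1 + ‖x‖) ^ (d + 1) * w (min l n) x := by gcongr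
    _ ≤ C * M (min l n) α := h1
    _ ≤ max C 1 * M l α := by
      gcongr
      exact le_max_left _ _

theorem gsTilde.decaysSmoothly (hM : IsWSS d M) (hW : IsWFS d w) (hψ : gsTilde d M w ψ) :
    DecaysSmoothly d ψ where
  contDiff := hψ.1
  bound s := by
    obtain ⟨α, hα⟩ := exists_foldr_pd_eq_pdMulti hψ.1 s
    obtain ⟨A, -, hA⟩ := hψ.exists_mul_le hM hW one_pos one_pos
    refine ⟨A * M 1 α, fun x => ?_⟩
    rw [hα]
    exact (le_mul_of_one_le_right (norm_nonneg _) (hW.one_le 1 one_pos x)).trans (hA α x)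

end GelfandShilov

/-- Continuity of the synthesis map `T_ψ((c_j)_j) = ∑_j c_j ψ(· − j)` from the Köthe sequence
space into the Beurling Gelfand–Shilov space. -/
theorem stmt9 (d : ℕ) (M : ℝ → (Fin d → ℕ) → ℝ) (w : ℝ → EuclideanSpace ℝ (Fin d) → ℝ)
    (hM : IsWSS d M) (hW : IsWFS d w) (hMcond : WFS_M_B d w)
    (q : ℝ≥0∞) (hq : 1 ≤ q)
    (ψ : EuclideanSpace ℝ (Fin d) → ℂ) (hψ : gsTilde d M w ψ) :
    ∀ l, 0 < l → ∃ m, 0 < m ∧ ∃ C, 0 < C ∧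
      ∀ c : (Fin d → ℤ) → ℂ,
        eLpNorm (fun j : Fin d → ℤ => ‖c j‖ * w m (intPt d j)) q Measure.count < ⊤ →
        (∀ (α : Fin d → ℕ) (x : EuclideanSpace ℝ (Fin d)),
          Summable fun j : Fin d → ℤ => ‖c j‖ * ‖pdMulti d α ψ (x - intPt d j)‖) ∧
        ContDiff ℝ (⊤ : ℕ∞) (fun x => ∑' j : Fin d → ℤ, c j * ψ (x - intPt d j)) ∧
        (∀ (α : Fin d → ℕ) (x : EuclideanSpace ℝ (Fin d)),
          pdMulti d α (fun y => ∑' j : Fin d → ℤ, c j * ψ (y - intPt d j)) x =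
            ∑' j : Fin d → ℤ, c j * pdMulti d α ψ (x - intPt d j)) ∧
        gsNorm d (M l) (w l) q (fun x => ∑' j : Fin d → ℤ, c j * ψ (x - intPt d j)) ≤
          ENNReal.ofReal C *
            eLpNorm (fun j : Fin d → ℤ => ‖c j‖ * w m (intPt d j)) q Measure.count := by
  intro l hl
  obtain ⟨m, hm, n, hn, C₀, hC₀, hw⟩ := hMcond l hl
  obtain ⟨A, hA, hψA⟩ := hψ.exists_mul_le hM hW hl hn
  obtain ⟨K, hK, hKle⟩ := exists_eLpNorm_tsum_decay_le d
  have hdec := hψ.decaysSmoothly hM hW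
  refine ⟨m, hm, C₀ * A * K, by positivity, fun c hc => ?_⟩
  set a : (Fin d → ℤ) → ℝ := fun j => ‖c j‖ * w m (intPt d j)
  have hwpos : ∀ {t}, 0 < t → ∀ x, 0 ≤ w t x := fun ht x => zero_le_one.trans (hW.one_le _ ht x)
  have ha : ∀ j, 0 ≤ a j := fun j => mul_nonneg (norm_nonneg _) (hwpos hm _)
  have hcN : ∀ j, ‖c j‖ ≤ (eLpNorm a q Measure.count).toReal := fun j => by
    have h := enorm_le_eLpNorm_count a j (zero_lt_one.trans_le hq).ne'
    have h2 := ENNReal.toReal_mono hc.ne h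
    rw [toReal_enorm, Real.norm_of_nonneg (ha j)] at h2
    exact (le_mul_of_one_le_right (norm_nonneg _) (hW.one_le m hm _)).trans h2
  have hsum : ∀ (α : Fin d → ℕ) (x : EuclideanSpace ℝ (Fin d)),
      Summable fun j : Fin d → ℤ => ‖c j‖ * ‖pdMulti d α ψ (x - intPt d j)‖ := fun α x =>
    (hdec.foldr_pdPow α _).summable hcN x
  refine ⟨hsum, hdec.contDiff_synth hcN,
    fun α x => congrFun (hdec.pdMulti_synth hcN α) x, ?_⟩
  change gsNorm d (M l) (w l) q (synth d c ψ) ≤ _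
  refine iSup_le fun α => ?_
  have hMpos := hM.pos l hl α
  refine ENNReal.div_le_of_le_mul ?_
  have hpt : ∀ x, ‖‖pdMulti d α (synth d c ψ) x‖ * w l x‖ₑ ≤ ENNReal.ofReal (C₀ * A * M l α) *
      ∑' j, ENNReal.ofReal (a j) * ENNReal.ofReal (decay d (x - intPt d j)) := by
    intro x
    have hwl := hwpos hl x
    rw [hdec.pdMulti_synth hcN, Real.enorm_eq_ofReal (by positivity)]
    have hterm : ∀ j, ‖c j‖ * ‖pdMulti d α ψ (x - intPt d j)‖ * w l x ≤
        C₀ * A * M l α * (a j * decay d (x - intPt d j)) := fun j => by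
      have h1 := hw (intPt d j) (x - intPt d j)
      rw [add_sub_cancel] at h1
      have h2 := hψA α (x - intPt d j)
      have hwm := hwpos hm (intPt d j)
      calc ‖c j‖ * ‖pdMulti d α ψ (x - intPt d j)‖ * w l x
          ≤ ‖c j‖ * ‖pdMulti d α ψ (x - intPt d j)‖ *
              (C₀ * w m (intPt d j) * w n (x - intPt d j)) := by gcongr
        _ = ‖c j‖ * C₀ * w m (intPt d j) *
              (‖pdMulti d α ψ (x - intPt d j)‖ * w n (x - intPt d j)) := by ring
        _ ≤ ‖c j‖ * C₀ * w m (intPt d j) * (A * M l α * decay d (x - intPt d j)) := by gcongr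
        _ = C₀ * A * M l α * (a j * decay d (x - intPt d j)) := by simp only [a]; ring
    have hnorm : ‖synth d c (pdMulti d α ψ) x‖ ≤
        ∑' j, ‖c j‖ * ‖pdMulti d α ψ (x - intPt d j)‖ := by
      have h := norm_tsum_le_tsum_norm (f := fun j => c j * pdMulti d α ψ (x - intPt d j))
        (by simpa using hsum α x)
      simpa [synth] using h
    calc ENNReal.ofReal (‖synth d c (pdMulti d α ψ) x‖ * w l x)
        ≤ ENNReal.ofReal (∑' j, ‖c j‖ * ‖pdMulti d α ψ (x - intPt d j)‖ * w l x) := by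
          rw [tsum_mul_right]
          gcongr
      _ = ∑' j, ENNReal.ofReal (‖c j‖ * ‖pdMulti d α ψ (x - intPt d j)‖ * w l x) :=
          ENNReal.ofReal_tsum_of_nonneg (fun j => by positivity) ((hsum α x).mul_right _)
      _ ≤ ∑' j, ENNReal.ofReal (C₀ * A * M l α) *
            (ENNReal.ofReal (a j) * ENNReal.ofReal (decay d (x - intPt d j))) := by
          gcongr with j
          rw [← ENNReal.ofReal_mul (ha j), ← ENNReal.ofReal_mul (by positivity)]
          exact ENNReal.ofReal_le_ofReal (hterm j)
      _ = _ := ENNReal.tsum_mul_left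
  have haq : eLpNorm (fun j => ENNReal.ofReal (a j)) q Measure.count =
      eLpNorm a q Measure.count :=
    eLpNorm_congr_enorm_ae (ae_of_all _ fun j => by
      rw [enorm_eq_self, Real.enorm_eq_ofReal (ha j)])
  calc eLpNorm (fun x => ‖pdMulti d α (synth d c ψ) x‖ * w l x) q volume
      ≤ ENNReal.ofReal (C₀ * A * M l α) * eLpNorm (fun x => ∑' j, ENNReal.ofReal (a j) *
          ENNReal.ofReal (decay d (x - intPt d j))) q volume :=
        eLpNorm_le_mul_eLpNorm_of_ae_le_mul' (ae_of_all _ hpt) q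
    _ ≤ ENNReal.ofReal (C₀ * A * M l α) *
          (ENNReal.ofReal K * eLpNorm (fun j => ENNReal.ofReal (a j)) q Measure.count) := by
        gcongr
        exact hKle q hq _
    _ = ENNReal.ofReal (C₀ * A * K) * eLpNorm a q Measure.count * ENNReal.ofReal (M l α) := by
        rw [haq, ENNReal.ofReal_mul (by positivity), ENNReal.ofReal_mul (q := K) (by positivity)]
        ring
end
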